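/- Let t ≥ 1 be an integer, let 0 < α < β < 1 be real numbers, let g be a real polynomial of degree at most t−1 that is not identically zero and has no roots in [β,1], and let λ_1 ∈ (α, β). Define f(λ) := (λ − λ_1)·g(λ) and h(λ) := (λ − α)·g(λ). Then (max_{λ∈[0,α]} |h(λ)|) / (min_{λ∈[β,1]} |h(λ)|) < (max_{λ∈[0,α]} |f(λ)|) / (min_{λ∈[β,1]} |f(λ)|). -/

import Mathlib

theorem move_root_to_alpha_decreases_ratio (t : ℕ) (ht : 1 ≤ t) (α β : ℝ)
    (h0α : 0 < α) (hαβ : α < β) (hβ1 : β < 1)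
    (g : Polynomial ℝ) (hgdeg : g.natDegree ≤ t - 1) (hg : g ≠ 0)
    (hgroots : ∀ x ∈ Set.Icc β 1, g.eval x ≠ 0)
    (lam₁ : ℝ) (hlam : lam₁ ∈ Set.Ioo α β)
    (f h : Polynomial ℝ)
    (hfdef : f = (Polynomial.X - Polynomial.C lam₁) * g)
    (hhdef : h = (Polynomial.X - Polynomial.C α) * g) :
    sSup ((fun x => |h.eval x|) '' Set.Icc 0 α) / sInf ((fun x => |h.eval x|) '' Set.Icc β 1) <
    sSup ((fun x => |f.eval x|) '' Set.Icc 0 α) / sInf ((fun x => |f.eval x|) '' Set.Icc β 1) := by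
  obtain ⟨hl1, hl2⟩ := hlam
  have cont : ∀ p : Polynomial ℝ, Continuous (fun x => |p.eval x|) := fun p =>
    p.continuous.abs
  have hf : ∀ x, |f.eval x| = |x - lam₁| * |g.eval x| := by
    intro x; rw [hfdef]; simp [abs_mul]
  have hh : ∀ x, |h.eval x| = |x - α| * |g.eval x| := by
    intro x; rw [hhdef]; simp [abs_mul]
  obtain ⟨x0, hx0, hx0e, -⟩ := isCompact_Icc.exists_sSup_image_eq_and_ge
    (Set.nonempty_Icc.2 h0α.le) (cont h).continuousOn
  obtain ⟨x1, hx1, hx1e, hx1m⟩ := isCompact_Icc.exists_sSup_image_eq_and_ge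
    (Set.nonempty_Icc.2 h0α.le) (cont f).continuousOn
  obtain ⟨y0, hy0, hy0e, -⟩ := isCompact_Icc.exists_sInf_image_eq_and_le
    (Set.nonempty_Icc.2 hβ1.le) (cont h).continuousOn
  obtain ⟨y1, hy1, hy1e, hy1m⟩ := isCompact_Icc.exists_sInf_image_eq_and_le
    (Set.nonempty_Icc.2 hβ1.le) (cont f).continuousOn
  rw [hx0e, hx1e, hy0e, hy1e]
  have hnum : |h.eval x0| ≤ |f.eval x1| := by
    refine le_trans ?_ (hx1m x0 hx0)
    rw [hf, hh, abs_of_nonpos (show x0 - α ≤ 0 by linarith [hx0.2]),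
      abs_of_nonpos (show x0 - lam₁ ≤ 0 by linarith [hx0.2])]
    exact mul_le_mul_of_nonneg_right (by linarith) (abs_nonneg _)
  have hdpos : 0 < |f.eval y1| := by
    rw [hf]
    exact mul_pos (abs_pos.2 (sub_ne_zero.2 (hl2.trans_le hy1.1).ne')) (abs_pos.2 (hgroots y1 hy1))
  have hden : |f.eval y1| < |h.eval y0| := by
    refine lt_of_le_of_lt (hy1m y0 hy0) ?_
    rw [hf, hh, abs_of_pos (show 0 < y0 - α by linarith [hy0.1]),
      abs_of_pos (show 0 < y0 - lam₁ by linarith [hy0.1])]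
    exact mul_lt_mul_of_pos_right (by linarith) (abs_pos.2 (hgroots y0 hy0))
  have hnpos : 0 < |f.eval x1| := by
    by_contra hc
    have hf0 : f = 0 := by
      refine Polynomial.eq_zero_of_infinite_isRoot f
        ((Set.Icc_infinite h0α).mono fun x hx => ?_)
      exact abs_nonpos_iff.1 ((hx1m x hx).trans (not_lt.1 hc))
    rw [hf0] at hdpos
    simp at hdpos
  calc |h.eval x0| / |h.eval y0| ≤ |f.eval x1| / |h.eval y0| := by gcongr
    _ < |f.eval x1| / |f.eval y1| := by gcongr
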